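/- Let D = (E, 𝓕) be a delta-matroid and let < be any total order on E. Then, as an identity of polynomials in y (equivalently, for all real y): Σ_{A ⊆ E} (y − 1)^{d(A)} = Σ_{F ∈ 𝓕} y^{i(F) + j(F)}; that is, q_Δ(D; y−1) = Σ_{F ∈ 𝓕} y^{i(F)+j(F)} where q_Δ(D;y) = Σ_{A ⊆ E} y^{d(A)} is the one-variable interlace polynomial. -/

import Mathlib

open Finset

/-- The symmetric exchange axiom for a collection of feasible sets. -/
def SymExch {α : Type*} [DecidableEq α] (𝓕 : Finset (Finset α)) : Prop :=
  ∀ X ∈ 𝓕, ∀ Y ∈ 𝓕, ∀ a ∈ symmDiff X Y, ∃ b ∈ symmDiff X Y, symmDiff X {a, b} ∈ 𝓕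

/-- A point `a` is `F`-nonorientable if `F Δ {a}` is feasible. -/
def FNonorientable {α : Type*} [DecidableEq α] (𝓕 : Finset (Finset α))
    (F : Finset α) (a : α) : Prop :=
  symmDiff F {a} ∈ 𝓕

/-- Distinct points `a` and `b` are `F`-interlaced if either at most one of
them is `F`-nonorientable and `F Δ {a,b}` is feasible, or both are
`F`-nonorientable and `F Δ {a,b}` is not feasible. -/
def FInterlaced {α : Type*} [DecidableEq α] (𝓕 : Finset (Finset α))
    (F : Finset α) (a b : α) : Prop :=
  a ≠ b ∧
    ((¬(FNonorientable 𝓕 F a ∧ FNonorientable 𝓕 F b) ∧ symmDiff F {a, b} ∈ 𝓕) ∨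
      (FNonorientable 𝓕 F a ∧ FNonorientable 𝓕 F b ∧ symmDiff F {a, b} ∉ 𝓕))

/-- A point is active with respect to `F` if no lower-ordered point is
`F`-interlaced with it. -/
def ActiveWrt {α : Type*} [LinearOrder α] (𝓕 : Finset (Finset α))
    (F : Finset α) (a : α) : Prop :=
  ∀ b, b < a → ¬ FInterlaced 𝓕 F b a

open Classical in
/-- The number of points of `A` that are active with respect to `F` and
`F`-orientable. -/
noncomputable def numActOr {α : Type*} [LinearOrder α] (𝓕 : Finset (Finset α))
    (F A : Finset α) : ℕ :=
  (A.filter fun a => ActiveWrt 𝓕 F a ∧ ¬ FNonorientable 𝓕 F a).card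

/-- `dmin 𝓕 B` is the minimum cardinality of `F Δ B` over feasible `F`. -/
noncomputable def dmin {α : Type*} [DecidableEq α] (𝓕 : Finset (Finset α))
    (B : Finset α) : ℕ :=
  sInf {n | ∃ F ∈ 𝓕, (symmDiff F B).card = n}

section Aux
variable {α : Type*}

/-- Section of a family at `s` (used with `s ⊆ {e}`). -/
def SecF [DecidableEq α] (𝓕 : Finset (Finset α)) (E s : Finset α) : Finset (Finset α) :=
  E.powerset.filter fun F => symmDiff F s ∈ 𝓕

lemma mem_SecF [DecidableEq α] {𝓕 : Finset (Finset α)} {E s F : Finset α} :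
    F ∈ SecF 𝓕 E s ↔ F ⊆ E ∧ symmDiff F s ∈ 𝓕 := by
  simp [SecF]

lemma dmin_le [DecidableEq α] {𝓕 : Finset (Finset α)} {F : Finset α} (hF : F ∈ 𝓕)
    (B : Finset α) : dmin 𝓕 B ≤ (symmDiff F B).card :=
  Nat.sInf_le ⟨F, hF, rfl⟩

lemma exists_dmin [DecidableEq α] {𝓕 : Finset (Finset α)} (h : 𝓕.Nonempty)
    (B : Finset α) : ∃ F ∈ 𝓕, (symmDiff F B).card = dmin 𝓕 B := by
  obtain ⟨F, hF⟩ := h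
  exact Nat.sInf_mem (s := {n | ∃ F ∈ 𝓕, (symmDiff F B).card = n}) ⟨_, F, hF, rfl⟩

lemma sd_cancel [DecidableEq α] (X Y s : Finset α) :
    symmDiff (symmDiff X s) (symmDiff Y s) = symmDiff X Y := by
  ext x; simp only [mem_symmDiff]; tauto

lemma sd_comm3 [DecidableEq α] (X Y s : Finset α) :
    symmDiff (symmDiff X s) Y = symmDiff (symmDiff X Y) s := by
  ext x; simp only [mem_symmDiff]; tauto

lemma SecF_exch [DecidableEq α] {𝓕 : Finset (Finset α)} (hex : SymExch 𝓕) (E s : Finset α) :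
    SymExch (SecF 𝓕 E s) := by
  intro X hX Y hY a ha
  rw [mem_SecF] at hX hY
  obtain ⟨b, hb, h⟩ := hex _ hX.2 _ hY.2 a (by rwa [sd_cancel])
  rw [sd_cancel] at hb
  refine ⟨b, hb, mem_SecF.2 ⟨?_, ?_⟩⟩
  · have h1 := hX.1
    have h2 := hY.1
    intro x hx
    simp only [mem_symmDiff, mem_insert, mem_singleton] at *
    grind
  · rwa [sd_comm3] at h

set_option maxHeartbeats 1000000 in
lemma dmin_SecF [DecidableEq α] {𝓕 : Finset (Finset α)} {E s : Finset α} {e : α}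
    (he : e ∉ E) (hs : s ⊆ {e}) (hsub : ∀ F ∈ 𝓕, F ⊆ insert e E) (hex : SymExch 𝓕)
    (hne : (SecF 𝓕 E s).Nonempty) {A : Finset α} (hA : A ⊆ E) :
    dmin 𝓕 (symmDiff A s) = dmin (SecF 𝓕 E s) A := by
  apply le_antisymm
  · obtain ⟨F, hF, h⟩ := exists_dmin hne A
    rw [← h, ← sd_cancel F A s]
    exact dmin_le (mem_SecF.1 hF).2 _
  · obtain ⟨H, hH⟩ := hne
    rw [mem_SecF] at hH
    obtain ⟨G, hG, h⟩ := exists_dmin ⟨_, hH.2⟩ (symmDiff A s)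
    have hGE := hsub G hG
    rw [← h]
    by_cases heG : e ∈ symmDiff G s
    · have heH : e ∈ symmDiff G (symmDiff H s) := by
        have : e ∉ H := fun h => he (hH.1 h)
        simp only [mem_symmDiff] at *
        tauto
      obtain ⟨b, hb, hb'⟩ := hex G hG _ hH.2 e heH
      have hF : symmDiff (symmDiff G {e, b}) s ∈ SecF 𝓕 E s := by
        refine mem_SecF.2 ⟨?_, ?_⟩
        · have h1 := hsub _ hb'
          intro x hx
          by_cases hxe : x = e
          · subst hxe
            simp only [mem_symmDiff, mem_insert, mem_singleton] at *
            grind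
          · have hxs : x ∉ s := fun h => hxe (by simpa using hs h)
            have : x ∈ symmDiff G {e, b} := by
              simp only [mem_symmDiff] at hx ⊢
              tauto
            simpa [hxe] using h1 this
        · rwa [symmDiff_symmDiff_cancel_right]
      refine (dmin_le hF A).trans ?_
      have hE : e ∈ symmDiff G (symmDiff A s) := by
        have : e ∉ A := fun h => he (hA h)
        simp only [mem_symmDiff] at *
        tauto
      have hss : symmDiff (symmDiff (symmDiff G {e, b}) s) A ⊆
          insert b ((symmDiff G (symmDiff A s)).erase e) := by
        intro x hx
        by_cases hxb : x = b
        · simp [hxb]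
        by_cases hxe : x = e
        · subst hxe
          exfalso
          have hxA : x ∉ A := fun h => he (hA h)
          simp only [mem_symmDiff] at heG
          simp only [mem_symmDiff, mem_insert, mem_singleton, hxA] at hx
          clear * - heG hx
          tauto
        · clear * - hx hxb hxe
          by_cases p : x ∈ G <;> by_cases q : x ∈ A <;> by_cases r : x ∈ s <;>
            simp_all [mem_symmDiff]
      refine (card_le_card hss).trans ((card_insert_le _ _).trans ?_)
      rw [card_erase_add_one hE]
    · have hF : symmDiff G s ∈ SecF 𝓕 E s := by
        refine mem_SecF.2 ⟨?_, ?_⟩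
        · intro x hx
          have hxe : x ≠ e := by rintro rfl; exact heG hx
          have hxs : x ∉ s := fun h => hxe (by simpa using hs h)
          have : x ∈ G := by
            simp only [mem_symmDiff] at hx
            tauto
          simpa [hxe] using hGE this
        · rwa [symmDiff_symmDiff_cancel_right]
      refine (dmin_le hF A).trans (le_of_eq ?_)
      congr 1
      rw [symmDiff_assoc, symmDiff_comm s A]

lemma mem_some [DecidableEq α] {𝓕 : Finset (Finset α)} {E s s' : Finset α} {e : α}
    (hs : s ⊆ {e}) (hs' : s' = symmDiff s {e})
    (hsub : ∀ F ∈ 𝓕, F ⊆ insert e E) {G : Finset α} (hG : G ∈ 𝓕) :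
    symmDiff G s ∈ SecF 𝓕 E s ∨ symmDiff G s' ∈ SecF 𝓕 E s' := by
  have h1 := hsub G hG
  simp only [mem_SecF, symmDiff_symmDiff_cancel_right, hG, and_true]
  by_cases he : e ∈ symmDiff G s
  · right
    intro x hx
    have := @h1 x
    have := @hs x
    subst hs'
    simp only [mem_symmDiff, mem_insert, mem_singleton] at *
    grind
  · left
    intro x hx
    have := @h1 x
    have := @hs x
    simp only [mem_symmDiff, mem_insert, mem_singleton] at *
    grind

lemma dmin_SecF' [DecidableEq α] {𝓕 : Finset (Finset α)} {E s s' : Finset α} {e : α}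
    (he : e ∉ E) (hs : s ⊆ {e}) (hs' : s' = symmDiff s {e})
    (hsub : ∀ F ∈ 𝓕, F ⊆ insert e E) (hne : 𝓕.Nonempty)
    (hem : SecF 𝓕 E s' = ∅) {A : Finset α} (hA : A ⊆ E) :
    dmin 𝓕 (symmDiff A s') = dmin (SecF 𝓕 E s) A + 1 := by
  have hall : ∀ G ∈ 𝓕, symmDiff G s ∈ SecF 𝓕 E s := by
    intro G hG
    rcases mem_some hs hs' hsub hG with h | h
    · exact h
    · simp [hem] at h
  have key : ∀ F ∈ SecF 𝓕 E s,
      (symmDiff (symmDiff F s) (symmDiff A s')).card = (symmDiff F A).card + 1 := by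
    intro F hF
    have h1 : e ∉ F := fun h => he ((mem_SecF.1 hF).1 h)
    have h2 : e ∉ A := fun h => he (hA h)
    have h3 : e ∉ symmDiff F A := by simp [mem_symmDiff, h1, h2]
    rw [← card_insert_of_notMem h3]
    congr 1
    subst hs'
    ext x
    by_cases hx : x = e
    · subst hx
      by_cases hxs : x ∈ s <;> simp [mem_symmDiff, h1, h2, hxs]
    · have hxs : x ∉ s := fun h => hx (by simpa using hs h)
      simp [mem_symmDiff, hx, hxs]
  have hne' : (SecF 𝓕 E s).Nonempty := by
    obtain ⟨G, hG⟩ := hne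
    exact ⟨_, hall G hG⟩
  apply le_antisymm
  · obtain ⟨F, hF, h⟩ := exists_dmin hne' A
    rw [← h, ← key F hF]
    exact dmin_le (mem_SecF.1 hF).2 _
  · obtain ⟨G, hG, h⟩ := exists_dmin hne (symmDiff A s')
    have h1 := key _ (hall G hG)
    rw [symmDiff_symmDiff_cancel_right] at h1
    rw [← h, h1]
    have := dmin_le (hall G hG) A
    omega

lemma SecF_shift [DecidableEq α] {𝓕 : Finset (Finset α)} {E s F T : Finset α} {e : α}
    (he : e ∉ E) (hs : s ⊆ {e}) (hsub : ∀ F ∈ 𝓕, F ⊆ insert e E) (hF : F ⊆ E) (hT : e ∉ T) :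
    symmDiff F T ∈ SecF 𝓕 E s ↔ symmDiff (symmDiff F s) T ∈ 𝓕 := by
  rw [mem_SecF, sd_comm3]
  refine ⟨fun h => h.2, fun h => ⟨?_, h⟩⟩
  intro x hx
  have h1 := @hsub _ h x
  have := @hs x
  have := @hF x
  simp only [mem_symmDiff, mem_insert, mem_singleton] at *
  grind

lemma numActOr_SecF [LinearOrder α] {𝓕 : Finset (Finset α)} {E s F : Finset α} {e : α}
    (he : ∀ x ∈ E, x < e) (hs : s ⊆ {e}) (hsub : ∀ F ∈ 𝓕, F ⊆ insert e E) (hF : F ⊆ E) :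
    numActOr (SecF 𝓕 E s) F E = numActOr 𝓕 (symmDiff F s) E := by
  have he' : e ∉ E := fun h => lt_irrefl _ (he e h)
  have hN : ∀ a, a ≠ e → (FNonorientable (SecF 𝓕 E s) F a ↔
      FNonorientable 𝓕 (symmDiff F s) a) := by
    intro a ha
    exact SecF_shift he' hs hsub hF (by simpa using ha.symm)
  classical
  unfold numActOr
  congr 1
  apply filter_congr
  intro a ha
  have hae := he a ha
  rw [hN a hae.ne]
  refine and_congr_left fun _ => ?_
  unfold ActiveWrt
  refine forall_congr' fun b => imp_congr_right fun hb => not_congr ?_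
  unfold FInterlaced
  rw [hN a hae.ne, hN b (hb.trans hae).ne,
    SecF_shift he' hs hsub hF (T := {b, a}) (by simp [hae.ne', (hb.trans hae).ne'])]

lemma numActOr_insert_ne [LinearOrder α] {𝓕 : Finset (Finset α)} {E s s' F : Finset α} {e : α}
    (he : ∀ x ∈ E, x < e) (hs' : s' = symmDiff s {e})
    (hsub : ∀ F ∈ 𝓕, F ⊆ insert e E) (hex : SymExch 𝓕)
    (hF : F ∈ SecF 𝓕 E s) (hne : (SecF 𝓕 E s').Nonempty) :
    numActOr 𝓕 (symmDiff F s) (insert e E) = numActOr 𝓕 (symmDiff F s) E := by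
  have he' : e ∉ E := fun h => lt_irrefl _ (he e h)
  unfold numActOr
  rw [filter_insert, if_neg]
  rintro ⟨hact, hor⟩
  obtain ⟨H, hH⟩ := hne
  rw [mem_SecF] at hF hH
  have h1 : e ∉ F := fun h => he' (hF.1 h)
  have h2 : e ∉ H := fun h => he' (hH.1 h)
  obtain ⟨b, hb, h⟩ := hex _ hF.2 _ hH.2 e (by
    subst hs'
    simp only [mem_symmDiff, mem_singleton]
    tauto)
  have hbe : b ≠ e := by
    rintro rfl
    apply hor
    simpa [FNonorientable] using h
  have hbE : b ∈ insert e E := by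
    have := hsub _ hF.2
    have := hsub _ hH.2
    rw [mem_symmDiff] at hb
    grind
  have hbE : b ∈ E := by simpa [hbe] using hbE
  refine hact b (he b hbE) ⟨hbe, Or.inl ⟨fun h => hor h.2, ?_⟩⟩
  rwa [pair_comm]

lemma numActOr_insert_empty [LinearOrder α] {𝓕 : Finset (Finset α)} {E s s' F : Finset α} {e : α}
    (he : ∀ x ∈ E, x < e) (hs' : s' = symmDiff s {e})
    (hs : s ⊆ {e})
    (hsub : ∀ F ∈ 𝓕, F ⊆ insert e E)
    (hF : F ∈ SecF 𝓕 E s) (hem : SecF 𝓕 E s' = ∅) :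
    numActOr 𝓕 (symmDiff F s) (insert e E) = numActOr 𝓕 (symmDiff F s) E + 1 := by
  have he' : e ∉ E := fun h => lt_irrefl _ (he e h)
  have h1 : e ∉ F := fun h => he' ((mem_SecF.1 hF).1 h)
  have key : ∀ T : Finset α, e ∈ T → symmDiff (symmDiff F s) T ∉ 𝓕 := by
    intro T hT h
    rcases mem_some hs hs' hsub h with h | h
    · have := (mem_SecF.1 h).1
      apply he'
      apply this
      simp only [mem_symmDiff]
      tauto
    · simp [hem] at h
  have hor : ¬ FNonorientable 𝓕 (symmDiff F s) e := key _ (by simp)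
  unfold numActOr
  rw [filter_insert, if_pos, card_insert_of_notMem (by simp [he'])]
  refine ⟨?_, hor⟩
  rintro b hb ⟨_, h | h⟩
  · exact key _ (by simp) h.2
  · exact hor h.2.1

lemma sum_split [DecidableEq α] {𝓕 : Finset (Finset α)} {E : Finset α} {e : α}
    (he : e ∉ E) (hsub : ∀ F ∈ 𝓕, F ⊆ insert e E) (f : Finset α → ℝ) :
    ∑ F ∈ 𝓕, f F = ∑ F ∈ SecF 𝓕 E ∅, f (symmDiff F ∅) +
      ∑ F ∈ SecF 𝓕 E {e}, f (symmDiff F {e}) := by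
  have h1 : 𝓕 = (insert e E).powerset.filter (· ∈ 𝓕) := by
    ext F
    simp only [mem_filter, mem_powerset]
    exact ⟨fun h => ⟨hsub F h, h⟩, fun h => h.2⟩
  conv_lhs => rw [h1]
  rw [sum_filter, sum_powerset_insert he]
  unfold SecF
  rw [sum_filter, sum_filter]
  congr 1
  · refine sum_congr rfl fun F _ => ?_
    have : symmDiff F ∅ = F := symmDiff_bot F
    rw [this]
  · refine sum_congr rfl fun F hF => ?_
    have : symmDiff F {e} = insert e F := by
      have : e ∉ F := fun h => he (mem_powerset.1 hF h)
      ext x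
      simp only [mem_symmDiff, mem_insert, mem_singleton]
      grind
    rw [this]

lemma main_aux [LinearOrder α] (E : Finset α) : ∀ (𝓕 : Finset (Finset α)),
    𝓕.Nonempty → (∀ F ∈ 𝓕, F ⊆ E) → SymExch 𝓕 → ∀ y : ℝ,
      ∑ A ∈ E.powerset, (y - 1) ^ dmin 𝓕 A = ∑ F ∈ 𝓕, y ^ numActOr 𝓕 F E := by
  induction E using Finset.induction_on_max with
  | empty =>
    intro 𝓕 hne hsub _ y
    have : 𝓕 = {∅} := by
      obtain ⟨F, hF⟩ := hne
      ext G
      have h1 : ∀ G ∈ 𝓕, G = ∅ := fun G hG => subset_empty.1 (hsub G hG)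
      rw [mem_singleton]
      exact ⟨h1 G, fun h => by rw [h, ← h1 F hF]; exact hF⟩
    subst this
    have h : dmin {(∅ : Finset α)} ∅ = 0 := by
      have := dmin_le (mem_singleton_self (∅ : Finset α)) ∅
      simpa using this
    simp [h, numActOr]
  | insert e E he ih =>
    intro 𝓕 hne hsub hex y
    have he' : e ∉ E := fun h => lt_irrefl _ (he e h)
    have hS : ∀ s, (SecF 𝓕 E s).Nonempty →
        ∑ A ∈ E.powerset, (y - 1) ^ dmin (SecF 𝓕 E s) A =
          ∑ F ∈ SecF 𝓕 E s, y ^ numActOr (SecF 𝓕 E s) F E := fun s hs =>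
      ih _ hs (fun F hF => (mem_SecF.1 hF).1) (SecF_exch hex E s) y
    have hL : ∑ A ∈ (insert e E).powerset, (y - 1) ^ dmin 𝓕 A =
        ∑ A ∈ E.powerset, (y - 1) ^ dmin 𝓕 (symmDiff A ∅) +
        ∑ A ∈ E.powerset, (y - 1) ^ dmin 𝓕 (symmDiff A {e}) := by
      have hE : ∀ s : Finset α, s ⊆ {e} → SecF (insert e E).powerset E s = E.powerset := by
        intro s hs
        unfold SecF
        rw [filter_true_of_mem]
        intro F hF
        rw [mem_powerset] at *
        intro x hx
        have := @hs x
        have := @hF x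
        simp only [mem_symmDiff, mem_insert, mem_singleton] at *
        tauto
      have := sum_split (𝓕 := (insert e E).powerset) he' (fun F hF => mem_powerset.1 hF)
        (fun A => (y - 1) ^ dmin 𝓕 A)
      rwa [hE _ (by simp), hE _ (by simp)] at this
    have hA : ∀ s s' : Finset α, s ⊆ {e} → s' = symmDiff s {e} →
        (SecF 𝓕 E s).Nonempty → (SecF 𝓕 E s').Nonempty →
        ∑ A ∈ E.powerset, (y - 1) ^ dmin 𝓕 (symmDiff A s) =
        ∑ F ∈ SecF 𝓕 E s, y ^ numActOr 𝓕 (symmDiff F s) (insert e E) := by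
      intro s s' hs hs' h h'
      rw [sum_congr rfl fun A hA => by
        rw [dmin_SecF he' hs hsub hex h (mem_powerset.1 hA)], hS s h]
      refine sum_congr rfl fun F hF => ?_
      rw [numActOr_insert_ne he hs' hsub hex hF h', numActOr_SecF he hs hsub (mem_SecF.1 hF).1]
    have hB : ∀ s s' : Finset α, s ⊆ {e} → s' = symmDiff s {e} →
        (SecF 𝓕 E s).Nonempty → SecF 𝓕 E s' = ∅ →
        ∑ A ∈ E.powerset, (y - 1) ^ dmin 𝓕 (symmDiff A s) +
        ∑ A ∈ E.powerset, (y - 1) ^ dmin 𝓕 (symmDiff A s') =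
        ∑ F ∈ SecF 𝓕 E s, y ^ numActOr 𝓕 (symmDiff F s) (insert e E) := by
      intro s s' hs hs' h h'
      have e1 : ∑ A ∈ E.powerset, (y - 1) ^ dmin 𝓕 (symmDiff A s) =
          ∑ A ∈ E.powerset, (y - 1) ^ dmin (SecF 𝓕 E s) A :=
        sum_congr rfl fun A hA => by
          rw [dmin_SecF he' hs hsub hex h (mem_powerset.1 hA)]
      have e2 : ∑ A ∈ E.powerset, (y - 1) ^ dmin 𝓕 (symmDiff A s') =
          (y - 1) * ∑ A ∈ E.powerset, (y - 1) ^ dmin (SecF 𝓕 E s) A := by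
        rw [mul_sum]
        refine sum_congr rfl fun A hA => ?_
        rw [dmin_SecF' he' hs hs' hsub hne h' (mem_powerset.1 hA), pow_succ']
      have e3 : ∑ F ∈ SecF 𝓕 E s, y ^ numActOr 𝓕 (symmDiff F s) (insert e E) =
          y * ∑ F ∈ SecF 𝓕 E s, y ^ numActOr (SecF 𝓕 E s) F E := by
        rw [mul_sum]
        refine sum_congr rfl fun F hF => ?_
        rw [numActOr_insert_empty he hs' hs hsub hF h',
          numActOr_SecF he hs hsub (mem_SecF.1 hF).1, pow_succ']
      rw [e1, e2, e3, hS s h]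
      ring
    rw [hL, sum_split he' hsub]
    have c1 : ({e} : Finset α) = symmDiff ∅ {e} := (bot_symmDiff _).symm
    have c2 : (∅ : Finset α) = symmDiff {e} {e} := (symmDiff_self _).symm
    rcases (SecF 𝓕 E ∅).eq_empty_or_nonempty with h0 | h0 <;>
      rcases (SecF 𝓕 E {e}).eq_empty_or_nonempty with h1 | h1
    · obtain ⟨G, hG⟩ := hne
      have := mem_some (s := ∅) (by simp) c1 hsub hG
      simp [h0, h1] at this
    · rw [add_comm, hB _ _ (by simp) c2 h1 h0, h0]
      simp
    · rw [hB _ _ (by simp) c1 h0 h1, h1]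
      simp
    · rw [hA _ _ (by simp) c1 h0 h1, hA _ _ (by simp) c2 h1 h0]

end Aux

/-- The activities-based feasible-set expansion of the one-variable
interlace polynomial: `q_Δ(D; y−1) = Σ_{F ∈ 𝓕} y^{i(F)+j(F)}`. -/
theorem oneVarInterlace_feasibleSet_expansion {α : Type*} [LinearOrder α]
    (E : Finset α) (𝓕 : Finset (Finset α))
    (hne : 𝓕.Nonempty) (hsub : ∀ F ∈ 𝓕, F ⊆ E) (hex : SymExch 𝓕) :
    ∀ y : ℝ,
      ∑ A ∈ E.powerset, (y - 1) ^ dmin 𝓕 A =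
        ∑ F ∈ 𝓕, y ^ (numActOr 𝓕 F F + numActOr 𝓕 F (E \ F)) := by
  intro y
  rw [main_aux E 𝓕 hne hsub hex y]
  refine sum_congr rfl fun F hF => ?_
  classical
  congr 1
  unfold numActOr
  rw [← card_union_of_disjoint (disjoint_filter_filter disjoint_sdiff), ← filter_union,
    union_sdiff_of_subset (hsub F hF)]
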